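/- arXiv:2002.03573 — 6 statements merged into one kernel-verified Lean document; each statement's English description precedes it below -/
import Mathlib

section
/- Let κ be a regular uncountable cardinal and let ⟨S_γ : γ < κ⟩ be a family of pairwise disjoint stationary subsets of κ such that the weak diamond Φ_{S_γ} holds for every γ < κ. Then for every family of colorings ⟨c_γ : γ < κ⟩ with c_γ : 2^{<κ} → 2 there exists a single function g : κ → 2 such that for every f : κ → 2 and every γ < κ the set {α < κ : c_γ(f↾α) = g(α)} is a stationary subset of κ. -/
noncomputable section

open Cardinal Set

namespace WDP

/-- `S` is an unbounded subset of the ordinals below `o`: `sup S = o`. -/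
def IsUnboundedIn (o : Ordinal) (S : Set Ordinal) : Prop :=
  S ⊆ Set.Iio o ∧ sSup S = o

/-- `C` is a club (closed unbounded) subset of the ordinals below `o`. -/
def IsClubIn (o : Ordinal) (C : Set Ordinal) : Prop :=
  IsUnboundedIn o C ∧ ∀ s ⊆ C, s.Nonempty → sSup s < o → sSup s ∈ C

/-- `S` is a stationary subset of the ordinals below `o`. -/
def IsStationaryIn (o : Ordinal) (S : Set Ordinal) : Prop :=
  S ⊆ Set.Iio o ∧ ∀ C, IsClubIn o C → (S ∩ C).Nonempty

/-- A coloring `c : 2^{<o} → 2`. -/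
def Coloring (o : Ordinal) :=
  (α : Set.Iio o) → (Set.Iio α.1 → Bool) → Bool

/-- The restriction `f ↾ α` of `f : o → 2` to `α < o`. -/
def restr {o : Ordinal} (f : Set.Iio o → Bool) (α : Set.Iio o) : Set.Iio α.1 → Bool :=
  fun β => f ⟨β.1, Set.mem_Iio.mpr ((Set.mem_Iio.mp β.2).trans (Set.mem_Iio.mp α.2))⟩

/-- The set `{α < o : c (f ↾ α) = g α}`. -/
def guessSet (o : Ordinal) (c : Coloring o) (f g : Set.Iio o → Bool) : Set Ordinal :=
  {β | ∃ h : β < o, c ⟨β, h⟩ (restr f ⟨β, h⟩) = g ⟨β, h⟩}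

/-- The weak diamond `Φ_S` on a set `S` of ordinals below `o`. -/
def WeakDiamondOn (o : Ordinal) (S : Set Ordinal) : Prop :=
  ∀ c : Coloring o, ∃ g : Set.Iio o → Bool, ∀ f : Set.Iio o → Bool,
    IsStationaryIn o (guessSet o c f g ∩ S)

/-- The weak diamond `Φ_o`. -/
def WeakDiamond (o : Ordinal) : Prop :=
  ∀ c : Coloring o, ∃ g : Set.Iio o → Bool, ∀ f : Set.Iio o → Bool,
    IsStationaryIn o (guessSet o c f g)

/-- The very weak diamond `Ψ_o`. -/
def VeryWeakDiamond (o : Ordinal) : Prop :=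
  ∀ c : Coloring o, ∃ g : Set.Iio o → Bool, ∀ f : Set.Iio o → Bool,
    IsUnboundedIn o (guessSet o c f g)

/-- The diamond principle `◊_o`. -/
def Diamond (o : Ordinal) : Prop :=
  ∃ A : Set.Iio o → Set Ordinal,
    (∀ α : Set.Iio o, A α ⊆ Set.Iio α.1) ∧
    ∀ X : Set Ordinal, X ⊆ Set.Iio o →
      IsStationaryIn o {β | ∃ h : β < o, A ⟨β, h⟩ = X ∩ Set.Iio β}

/-- `κ` is a measurable cardinal: it is uncountable and carries a κ-complete
nonprincipal ultrafilter. -/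
def IsMeasurableCard (κ : Cardinal) : Prop :=
  Cardinal.aleph0 < κ ∧
  ∃ U : Ultrafilter (Set.Iio κ.ord),
    (∀ α : Set.Iio κ.ord, ({α}ᶜ : Set (Set.Iio κ.ord)) ∈ U) ∧
    ∀ (τ : Ordinal), τ < κ.ord → ∀ s : Set.Iio τ → Set (Set.Iio κ.ord),
      (∀ i, s i ∈ U) → (⋂ i, s i) ∈ U

/-- The parametrized weak diamond `θ-Φ_κ`. -/
def ParamWeakDiamond (κ : Cardinal) (θ : Cardinal) : Prop :=
  ∀ c : Coloring κ.ord, ∃ g : Set.Iio θ.ord → (Set.Iio κ.ord → Bool),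
    ∀ f : Set.Iio κ.ord → Bool, ∃ τ, IsStationaryIn κ.ord (guessSet κ.ord c f (g τ))

theorem IsStationaryIn.mono {o : Ordinal} {S T : Set Ordinal} (hS : IsStationaryIn o S)
    (hST : S ⊆ T) (hT : T ⊆ Set.Iio o) : IsStationaryIn o T :=
  ⟨hT, fun C hC => (hS.2 C hC).mono (Set.inter_subset_inter_left C hST)⟩

theorem guessSet_subset_Iio (o : Ordinal) (c : Coloring o) (f g : Set.Iio o → Bool) :
    guessSet o c f g ⊆ Set.Iio o :=
  fun _ h => h.1

theorem weak_diamond_simultaneous_from_partition (κ : Cardinal)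
    (hreg : κ.IsRegular) (hunc : Cardinal.aleph0 < κ)
    (S : Set.Iio κ.ord → Set Ordinal)
    (hdisj : ∀ γ γ' : Set.Iio κ.ord, γ ≠ γ' → Disjoint (S γ) (S γ'))
    (hstat : ∀ γ, IsStationaryIn κ.ord (S γ))
    (hwd : ∀ γ, WeakDiamondOn κ.ord (S γ))
    (c : Set.Iio κ.ord → Coloring κ.ord) :
    ∃ g : Set.Iio κ.ord → Bool, ∀ f : Set.Iio κ.ord → Bool, ∀ γ : Set.Iio κ.ord,
      IsStationaryIn κ.ord (guessSet κ.ord (c γ) f g) := by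
  classical
  choose G hG using fun γ => hwd γ (c γ)
  refine ⟨fun α => if h : ∃ γ, α.1 ∈ S γ then G h.choose α else false, fun f γ =>
    (hG γ f).mono ?_ (guessSet_subset_Iio _ _ _ _)⟩
  rintro β ⟨⟨hβ, hguess⟩, hβS⟩
  have hex : ∃ γ, β ∈ S γ := ⟨γ, hβS⟩
  have hchoose : hex.choose = γ := by
    by_contra hne
    exact Set.disjoint_left.mp (hdisj _ _ hne) hex.choose_spec hβS
  exact ⟨hβ, hguess.trans ((dif_pos hex).trans (by rw [hchoose])).symm⟩

end WDP
end
end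

section
/- Let κ be a measurable cardinal. Suppose c_γ : 2^{<κ} → 2 is given for every γ < κ. Then there exists a function g : κ → 2 such that for every f : κ → 2 and every γ < κ the set {α < κ : c_γ(f↾α) = g(α)} is a stationary subset of κ. -/
noncomputable section

open Cardinal Set

namespace WDP

open Filter

/-- `V` is a normal ultrafilter concentrating on the ordinals below `o` and containing all the
final segments of `o`. -/
structure IsNormalUltrafilterOn (o : Ordinal) (V : Ultrafilter Ordinal) : Prop where
  eventually_lt : ∀ᶠ α in (V : Filter Ordinal), α < o
  eventually_gt : ∀ ξ < o, ∀ᶠ α in (V : Filter Ordinal), ξ < α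
  eventually_eq_of_regressive : ∀ f : Ordinal → Ordinal,
    (∀ᶠ α in (V : Filter Ordinal), f α < α) → ∃ ξ, ∀ᶠ α in (V : Filter Ordinal), f α = ξ

/-- The order modulo a countably complete ultrafilter on functions into the ordinals is
well-founded. -/
theorem wellFounded_eventually_lt {X : Type*} (U : Ultrafilter X)
    (hU : ∀ s : ℕ → Set X, (∀ n, s n ∈ U) → (⋂ n, s n) ∈ U) :
    WellFounded fun f g : X → Ordinal => ∀ᶠ a in (U : Filter X), f a < g a := by
  rw [wellFounded_iff_isEmpty_descending_chain]
  refine ⟨fun ⟨F, hF⟩ => ?_⟩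
  obtain ⟨a, ha⟩ := U.nonempty_of_mem (hU (fun n => {a | F (n + 1) a < F n a}) hF)
  rw [mem_iInter] at ha
  exact (wellFounded_iff_isEmpty_descending_chain.1
    (wellFounded_lt (α := Ordinal))).false ⟨fun n => F n a, ha⟩

/-- Measurable cardinals carry normal ultrafilters. -/
theorem IsMeasurableCard.exists_normal {κ : Cardinal} (hκ : IsMeasurableCard κ) :
    ∃ V, IsNormalUltrafilterOn κ.ord V := by
  obtain ⟨hω, U, hnp, hc⟩ := hκ
  have hlim : Order.IsSuccLimit κ.ord := isSuccLimit_ord hω.le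
  have hconst : ∀ τ < κ.ord, ∀ f : Iio κ.ord → Ordinal,
      (∀ᶠ a in (U : Filter _), f a < τ) → ∃ i, ∀ᶠ a in (U : Filter _), f a = i := by
    intro τ hτ f hf
    by_contra hne
    have hne' : ∀ i, ∀ᶠ a in (U : Filter _), f a ≠ i := fun i =>
      Ultrafilter.eventually_not.2 fun hi => hne ⟨i, hi⟩
    have h := hc τ hτ (fun i => {a | f a ≠ i.1})
      fun i => hne' i.1
    obtain ⟨a, ha, ha'⟩ := U.nonempty_of_mem (inter_mem h hf)
    exact mem_iInter.1 ha ⟨f a, ha'⟩ rfl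
  have hctble : ∀ s : ℕ → Set (Iio κ.ord), (∀ n, s n ∈ U) → (⋂ n, s n) ∈ U := by
    intro s hs
    have hωκ : Ordinal.omega0 < κ.ord := by
      rw [← ord_aleph0]; exact ord_lt_ord.2 hω
    have h := hc _ hωκ (fun i => s (Ordinal.lt_omega0.1 i.2).choose) fun i => hs _
    refine mem_of_superset h fun a ha => mem_iInter.2 fun n => ?_
    have hn := mem_iInter.1 ha ⟨n, Ordinal.natCast_lt_omega0 n⟩
    have := (Ordinal.lt_omega0.1 (Ordinal.natCast_lt_omega0 n)).choose_spec
    rw [Nat.cast_inj] at this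
    exact this.symm ▸ hn
  let P : Set (Iio κ.ord → Ordinal) :=
    {f | (∀ᶠ a in (U : Filter _), f a < κ.ord) ∧
      ∀ ξ < κ.ord, ∀ᶠ a in (U : Filter _), ξ < f a}
  have hconst' : ∀ f : Iio κ.ord → Ordinal, (∀ᶠ a in (U : Filter _), f a < κ.ord) → f ∉ P →
      ∃ i, ∀ᶠ a in (U : Filter _), f a = i := by
    intro f hf hfP
    have : ¬ ∀ ξ < κ.ord, ∀ᶠ a in (U : Filter _), ξ < f a := fun h => hfP ⟨hf, h⟩
    push Not at this
    obtain ⟨ξ, hξ, h⟩ := this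
    refine hconst (Order.succ ξ) (hlim.succ_lt hξ) f ?_
    filter_upwards [h] with a ha
    exact Order.lt_succ_of_le ha
  have hid : (fun a : Iio κ.ord => a.1) ∈ P := by
    have hlt : ∀ᶠ a : Iio κ.ord in (U : Filter _), a.1 < κ.ord := .of_forall fun a => a.2
    by_contra hP
    obtain ⟨i, hi⟩ := hconst' _ hlt hP
    obtain ⟨a, ha⟩ := hi.exists
    obtain ⟨b, hb, hb'⟩ := (hi.and (hnp a)).exists
    exact hb' (Subtype.ext (hb.trans ha.symm))
  obtain ⟨h, hh, hmin⟩ := (wellFounded_eventually_lt U hctble).has_min P ⟨_, hid⟩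
  refine ⟨U.map h, hh.1, hh.2, fun f hf => ?_⟩
  refine hconst' (fun a => f (h a)) ?_ fun hP => hmin _ hP hf
  filter_upwards [hh.1, (hf : ∀ᶠ a in (U : Filter _), f (h a) < h a)] with a h1 h2
  exact h2.trans h1

/-- A normal ultrafilter coheres every sequence of sets `A α`, restricted to `α`. -/
theorem IsNormalUltrafilterOn.exists_coherent {o : Ordinal} {V : Ultrafilter Ordinal}
    (hV : IsNormalUltrafilterOn o V) (A : Ordinal → Set Ordinal) :
    ∃ D : Set Ordinal, ∀ᶠ α in (V : Filter Ordinal), ∀ ξ < α, ξ ∈ A α ↔ ξ ∈ D := by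
  refine ⟨{ξ | ∀ᶠ α in (V : Filter Ordinal), ξ ∈ A α}, ?_⟩
  by_contra hD
  set D : Set Ordinal := {ξ | ∀ᶠ α in (V : Filter Ordinal), ξ ∈ A α} with hDdef
  choose! f hf using fun α (h : ∃ ξ < α, ¬ (ξ ∈ A α ↔ ξ ∈ D)) => h
  have hne : ∀ᶠ α in (V : Filter Ordinal), ∃ ξ < α, ¬ (ξ ∈ A α ↔ ξ ∈ D) := by
    filter_upwards [Ultrafilter.eventually_not.2 hD] with α h
    by_contra! h'
    exact h h'
  obtain ⟨ξ, hξ⟩ := hV.eventually_eq_of_regressive f (hne.mono fun α h => (hf α h).1)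
  have hdiff : ∀ᶠ α in (V : Filter Ordinal), ¬ (ξ ∈ A α ↔ ξ ∈ D) := by
    filter_upwards [hne, hξ] with α h1 h2
    exact h2 ▸ (hf α h1).2
  by_cases hξD : ξ ∈ D
  · obtain ⟨α, h1, h2⟩ := (hdiff.and hξD).exists
    exact h1 (iff_of_true h2 hξD)
  · exact hξD (hdiff.mono fun α h => by tauto)

/-- A normal ultrafilter concentrates on the limit points of any unbounded set. -/
theorem IsNormalUltrafilterOn.eventually_limit {o : Ordinal} {V : Ultrafilter Ordinal}
    (hV : IsNormalUltrafilterOn o V) {C : Set Ordinal} (hCo : C ⊆ Iio o)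
    (hC : ∀ ξ < o, ∃ c ∈ C, ξ < c) :
    ∀ᶠ α in (V : Filter Ordinal), ∀ ξ < α, ∃ c ∈ C, ξ < c ∧ c < α := by
  by_contra hn
  have hn' := Ultrafilter.eventually_not.2 hn
  push Not at hn'
  choose! f hf using fun α (h : ∃ ξ < α, ∀ c ∈ C, ξ < c → α ≤ c) => h
  obtain ⟨ξ, hξ⟩ := hV.eventually_eq_of_regressive f (hn'.mono fun α h => (hf α h).1)
  obtain ⟨α, ⟨h1, h2⟩, h3⟩ := ((hn'.and hξ).and hV.eventually_lt).exists
  have hξo : ξ < o := h2 ▸ (hf α h1).1.trans h3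
  obtain ⟨c, hc, hξc⟩ := hC ξ hξo
  obtain ⟨β, ⟨h4, h5⟩, h6⟩ := ((hn'.and hξ).and (hV.eventually_gt c (hCo hc))).exists
  exact h6.not_ge ((hf β h4).2 c hc (h5 ▸ hξc))

/-- `(X, γ, C)` witnesses that the guesses `d` made before `α` all fail along a club `C` of `α`. -/
structure IsBadAt (α : Ordinal) (d : (β : Ordinal) → β < α → Set Ordinal × Ordinal)
    (X : Set Ordinal) (γ : Ordinal) (C : Set Ordinal) : Prop where
  lt : γ < α
  unbounded : ∀ ξ < α, ∃ c ∈ C, ξ < c ∧ c < α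
  closed : ∀ δ < α, 0 < δ → (∀ ξ < δ, ∃ c ∈ C, ξ < c ∧ c < δ) → δ ∈ C
  fails : ∀ β (h : β < α), β ∈ C →
    ¬ ((∀ ξ < β, ξ ∈ X ↔ ξ ∈ (d β h).1) ∧ (d β h).2 = γ)

open Classical in
/-- A triple that is bad at `α` if there is one. -/
def badTriple (α : Ordinal) (d : (β : Ordinal) → β < α → Set Ordinal × Ordinal) :
    Set Ordinal × Ordinal × Set Ordinal :=
  if h : ∃ p : Set Ordinal × Ordinal × Set Ordinal, IsBadAt α d p.1 p.2.1 p.2.2 then h.choose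
  else (∅, 0, ∅)

theorem isBadAt_badTriple {α : Ordinal} {d : (β : Ordinal) → β < α → Set Ordinal × Ordinal}
    {X : Set Ordinal} {γ : Ordinal} {C : Set Ordinal} (h : IsBadAt α d X γ C) :
    IsBadAt α d (badTriple α d).1 (badTriple α d).2.1 (badTriple α d).2.2 := by
  have h' : ∃ p : Set Ordinal × Ordinal × Set Ordinal, IsBadAt α d p.1 p.2.1 p.2.2 :=
    ⟨(X, γ, C), h⟩
  rw [badTriple, dif_pos h']
  exact h'.choose_spec

/-- The diamond sequence, guessing pairs `(X ∩ α, γ)`. -/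
def guess (α : Ordinal) : Set Ordinal × Ordinal :=
  let p := badTriple α fun β _ => guess β
  (p.1, p.2.1)
termination_by α

/-- Diamond holds at `o`, in a version that guesses a subset of `o` and an ordinal below `o`. -/
theorem IsNormalUltrafilterOn.exists_guess_eq {o : Ordinal} {V : Ultrafilter Ordinal}
    (hV : IsNormalUltrafilterOn o V) (X : Set Ordinal) {γ : Ordinal} (hγ : γ < o)
    {C : Set Ordinal} (hCo : C ⊆ Iio o) (hC : ∀ ξ < o, ∃ c ∈ C, ξ < c)
    (hcl : ∀ δ < o, 0 < δ → (∀ ξ < δ, ∃ c ∈ C, ξ < c ∧ c < δ) → δ ∈ C) :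
    ∃ α ∈ C, (∀ ξ < α, ξ ∈ X ↔ ξ ∈ (guess α).1) ∧ (guess α).2 = γ := by
  by_contra! hfail
  let D : Ordinal → Set Ordinal := fun α => (badTriple α fun β _ => guess β).2.2
  have hbad : ∀ᶠ α in (V : Filter Ordinal),
      IsBadAt α (fun β _ => guess β) (guess α).1 (guess α).2 (D α) := by
    filter_upwards [hV.eventually_lt, hV.eventually_gt γ hγ, hV.eventually_limit hCo hC]
      with α h1 h2 h3
    have h : IsBadAt α (fun β _ => guess β) X γ C :=
      ⟨h2, h3, fun δ hδ => hcl δ (hδ.trans h1), fun β _ hβ h => hfail β hβ h.1 h.2⟩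
    rw [guess]
    exact isBadAt_badTriple h
  obtain ⟨A, hA⟩ := hV.exists_coherent fun α => (guess α).1
  obtain ⟨E, hE⟩ := hV.exists_coherent D
  obtain ⟨ε, hε⟩ := hV.eventually_eq_of_regressive (fun α => (guess α).2)
    (hbad.mono fun α h => h.lt)
  have hall := hbad.and (hA.and (hE.and hε))
  obtain ⟨α, ⟨hbα, hAα, hEα, hεα⟩, hαo⟩ := (hall.and hV.eventually_lt).exists
  obtain ⟨β, ⟨hbβ, hAβ, hEβ, hεβ⟩, hαβ⟩ := (hall.and (hV.eventually_gt α hαo)).exists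
  have hmem : α ∈ D β := by
    refine hbβ.closed α hαβ (zero_le.trans_lt hbα.lt) fun ξ hξ => ?_
    obtain ⟨c, hc, hξc, hcα⟩ := hbα.unbounded ξ hξ
    exact ⟨c, (hEβ c (hcα.trans hαβ)).2 ((hEα c hcα).1 hc), hξc, hcα⟩
  exact hbβ.fails α hαβ hmem
    ⟨fun ξ hξ => (hAβ ξ (hξ.trans hαβ)).trans (hAα ξ hξ).symm, hεα.trans hεβ.symm⟩

theorem IsClubIn.exists_gt {o : Ordinal} {C : Set Ordinal} (hC : IsClubIn o C) {ξ : Ordinal}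
    (hξ : ξ < o) : ∃ c ∈ C, ξ < c := by
  refine exists_lt_of_lt_csSup' ?_
  rwa [hC.1.2]

theorem IsClubIn.mem_of_limit {o : Ordinal} {C : Set Ordinal} (hC : IsClubIn o C) {δ : Ordinal}
    (hδo : δ < o) (hδ : 0 < δ) (h : ∀ ξ < δ, ∃ c ∈ C, ξ < c ∧ c < δ) : δ ∈ C := by
  have hlub : IsLUB (C ∩ Iio δ) δ := by
    refine ⟨fun c hc => hc.2.le, fun b hb => ?_⟩
    by_contra! hbδ
    obtain ⟨c, hc, hbc, hcδ⟩ := h b hbδ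
    exact (hb ⟨hc, hcδ⟩).not_gt hbc
  have hne : (C ∩ Iio δ).Nonempty := by
    obtain ⟨c, hc, -, hcδ⟩ := h 0 hδ
    exact ⟨c, hc, hcδ⟩
  have hs := hlub.csSup_eq hne
  rw [← hs]
  exact hC.2 _ inter_subset_left hne (by rwa [hs])

theorem weak_diamond_simultaneous_of_measurable (κ : Cardinal)
    (hmeas : IsMeasurableCard κ)
    (c : Set.Iio κ.ord → Coloring κ.ord) :
    ∃ g : Set.Iio κ.ord → Bool, ∀ f : Set.Iio κ.ord → Bool, ∀ γ : Set.Iio κ.ord,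
      IsStationaryIn κ.ord (guessSet κ.ord (c γ) f g) := by
  classical
  obtain ⟨V, hV⟩ := hmeas.exists_normal
  refine ⟨fun α => if h : (guess α.1).2 < κ.ord then
    c ⟨_, h⟩ α (fun ξ => decide (ξ.1 ∈ (guess α.1).1)) else false, fun f γ =>
    ⟨fun β hβ => hβ.1, fun C hC => ?_⟩⟩
  obtain ⟨α, hα, hX, hγ⟩ := hV.exists_guess_eq {ξ | ∃ h : ξ < κ.ord, f ⟨ξ, h⟩ = true} γ.2 hC.1.1
    (fun ξ => hC.exists_gt) fun δ => hC.mem_of_limit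
  have hακ : α < κ.ord := hC.1.1 hα
  refine ⟨α, ⟨hακ, ?_⟩, hα⟩
  have hγ' : (guess α).2 < κ.ord := hγ ▸ γ.2
  have hγeq : (⟨_, hγ'⟩ : Iio κ.ord) = γ := Subtype.ext hγ
  refine Eq.trans ?_ (dif_pos hγ').symm
  rw [hγeq]
  congr 1
  funext ξ
  have hξκ : ξ.1 < κ.ord := lt_trans ξ.2 hακ
  rw [Bool.eq_iff_iff, decide_eq_true_iff, ← hX ξ.1 ξ.2]
  exact ⟨fun h => ⟨hξκ, h⟩, fun ⟨_, h⟩ => h⟩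

end WDP
end
end

section
/- If λ is a strongly inaccessible cardinal then the very weak diamond Ψ_λ holds. -/
noncomputable section

open Cardinal Set

namespace WDP

/-- If each member of a sequence of functions is computed by `c` from its successor at every
point `≥ β`, then the sequence is determined by its restrictions to `β`. -/
theorem eq_of_restr_eq_of_coloring_eq {o : Ordinal} (c : Coloring o) (s t : ℕ → Set.Iio o → Bool)
    (β : Set.Iio o) (hs : ∀ n, ∀ α, β ≤ α → c α (restr (s (n + 1)) α) = s n α)
    (ht : ∀ n, ∀ α, β ≤ α → c α (restr (t (n + 1)) α) = t n α)
    (hst : ∀ n, restr (s n) β = restr (t n) β) : s = t := by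
  suffices H : ∀ α : Set.Iio o, ∀ n, s n α = t n α from funext fun n => funext fun α => H α n
  intro α
  induction α using WellFoundedLT.induction with
  | ind α ih =>
    intro n
    rcases lt_or_ge α β with hα | hα
    · exact congrFun (hst n) ⟨α.1, hα⟩
    · rw [← hs n α hα, ← ht n α hα]
      congr 1
      funext γ
      exact ih ⟨γ.1, _⟩ γ.2 (n + 1)

/-- If `IsUnboundedIn` fails for a set of ordinals below `o`, the set misses a tail of `o`. -/
theorem exists_forall_ge_notMem_of_not_isUnboundedIn {o : Ordinal} (ho : Order.IsSuccLimit o)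
    {S : Set Ordinal} (hS : S ⊆ Set.Iio o) (h : ¬ IsUnboundedIn o S) :
    ∃ β : Set.Iio o, ∀ α, β.1 ≤ α → α ∉ S := by
  have hle : sSup S ≤ o := csSup_le' fun x hx => (hS hx).le
  have hlt : sSup S < o := lt_of_le_of_ne hle fun e => h ⟨hS, e⟩
  refine ⟨⟨Order.succ (sSup S), ho.succ_lt hlt⟩, fun α hα hmem => ?_⟩
  have hbdd : BddAbove S := ⟨o, fun x hx => (hS hx).le⟩
  exact (Order.succ_le_iff.1 hα).not_ge (le_csSup hbdd hmem)

/-- Below a strong limit cardinal `κ > ℵ₀` there are at most `κ` countable sequences of functions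
`β → 2` with `β < κ`. -/
theorem mk_sigma_nat_bool_le.{u} {κ : Cardinal.{u}} (h : κ.IsStrongLimit) (hκ : ℵ₀ < κ) :
    #(Σ β : Set.Iio κ.ord, ℕ → Set.Iio β.1 → Bool) ≤ lift.{u + 1} κ := by
  have hκ' : ℵ₀ ≤ lift.{u + 1} κ := by simpa using hκ.le
  have hβ (β : Set.Iio κ.ord) : #(ℕ → Set.Iio β.1 → Bool) ≤ lift.{u + 1} κ := by
    have hlt : β.1.card * ℵ₀ < κ := mul_lt_of_lt hκ.le (lt_ord.1 β.2) hκ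
    have hpow : #(ℕ → Set.Iio β.1 → Bool) = lift.{u + 1} (2 ^ (β.1.card * ℵ₀)) := by
      simp [power_mul, mk_Iio_ordinal]
    rw [hpow, lift_le]
    exact (h.isStrongPrelimit hlt).le
  calc #(Σ β : Set.Iio κ.ord, ℕ → Set.Iio β.1 → Bool)
      = sum fun β : Set.Iio κ.ord => #(ℕ → Set.Iio β.1 → Bool) := mk_sigma _
    _ ≤ sum fun _ : Set.Iio κ.ord => lift.{u + 1} κ := sum_le_sum _ _ hβ
    _ = lift.{u + 1} κ := by
      rw [sum_const', mk_Iio_ordinal, card_ord, mul_eq_self hκ']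

theorem veryWeakDiamond_of_inaccessible (lam : Cardinal)
    (h : lam.IsInaccessible) : VeryWeakDiamond lam.ord := by
  intro c
  by_contra! hc
  have hlim : Order.IsSuccLimit lam.ord := isSuccLimit_ord h.aleph0_lt.le
  have hcode (g : Set.Iio lam.ord → Bool) : ∃ f : Set.Iio lam.ord → Bool, ∃ β : Set.Iio lam.ord,
      ∀ α, β ≤ α → c α (restr f α) = g α := by
    obtain ⟨f, hf⟩ := hc fun α => !g α
    obtain ⟨β, hβ⟩ := exists_forall_ge_notMem_of_not_isUnboundedIn hlim (fun _ hα => hα.1) hf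
    refine ⟨f, β, fun α hα => ?_⟩
    by_contra hne
    exact hβ α.1 hα ⟨α.2, Bool.eq_not.2 hne⟩
  choose F B hFB using hcode
  let s (g : Set.Iio lam.ord → Bool) (n : ℕ) : Set.Iio lam.ord → Bool := F^[n] g
  have hsup (g : Set.Iio lam.ord → Bool) : ∃ β : Set.Iio lam.ord, ∀ n, B (s g n) ≤ β := by
    refine ⟨⟨⨆ n, (B (s g n)).1, Ordinal.lift_iSup_lt_of_lt_cof ?_ fun n => (B (s g n)).2⟩,
      fun n => Ordinal.le_iSup (fun n => (B (s g n)).1) n⟩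
    simpa using h.aleph0_lt.trans_le h.le_cof_ord
  choose β hβ using hsup
  have hs (g : Set.Iio lam.ord → Bool) (n : ℕ) (α : Set.Iio lam.ord) (hα : β g ≤ α) :
      c α (restr (s g (n + 1)) α) = s g n α := by
    simp only [s, Function.iterate_succ_apply']
    exact hFB _ α ((hβ g n).trans hα)
  let Φ (g : Set.Iio lam.ord → Bool) : Σ β : Set.Iio lam.ord, ℕ → Set.Iio β.1 → Bool :=
    ⟨β g, fun n => restr (s g n) (β g)⟩
  have hΦ : Function.Injective Φ := by
    intro g₁ g₂ heq
    have h₁ := hs g₁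
    have h₂ := hs g₂
    simp only [Φ] at heq
    generalize β g₁ = b₁ at heq h₁
    generalize β g₂ = b₂ at heq h₂
    obtain ⟨rfl, hr⟩ := Sigma.mk.inj heq
    exact congrFun (eq_of_restr_eq_of_coloring_eq c _ _ b₁ h₁ h₂ (congrFun (eq_of_heq hr))) 0
  have hle := (mk_le_of_injective hΦ).trans (mk_sigma_nat_bool_le h.isStrongLimit h.aleph0_lt)
  rw [mk_arrow, mk_Iio_ordinal, card_ord] at hle
  refine (cantor _).not_ge (hle.trans' ?_)
  simp

end WDP
end
end

section
/- Let λ be a weakly inaccessible cardinal (i.e., a regular uncountable limit cardinal). If there exists a cardinal κ < λ such that 2^{<λ} = 2^κ < 2^λ (where 2^{<λ} = sup{2^θ : θ < λ, θ a cardinal}), then the weak diamond Φ_λ holds. -/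
noncomputable section

open Cardinal Set

namespace WDP

section Tower

universe v

variable {A K : Type v} [LinearOrder A] {c : (A → Bool) → A → Bool}
  {e : A → (K → A → Bool) → K → Bool} {H H' : ℕ → K → A → Bool} {C C' : ℕ → Set A}

/-- A decreasing sequence of clubs `C n` and families `H n` of branches such that, at each point `a`
of `C (n + 1)`, the coloring `c` of `H (n + 1)` at `a` is the code of `H n` up to the next point
of `C n`. -/
structure IsCodingTower (c : (A → Bool) → A → Bool) (e : A → (K → A → Bool) → K → Bool)
    (H : ℕ → K → A → Bool) (C : ℕ → Set A) : Prop where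
  isClub : ∀ n, IsClub (C n)
  succ_subset : ∀ n, C (n + 1) ⊆ C n
  code : ∀ n, ∀ a ∈ C (n + 1), ∀ b, IsLeast (C n ∩ Ioi a) b →
    ∀ k, c (H (n + 1) k) a = e b (H n) k

theorem exists_isLeast_inter_Ioi [WellFoundedLT A] [NoMaxOrder A] {s : Set A} (hs : IsCofinal s)
    (a : A) : ∃ b, IsLeast (s ∩ Ioi a) b := by
  obtain ⟨a', ha'⟩ := exists_gt a
  obtain ⟨b, hb, hab⟩ := hs a'
  have hne : (s ∩ Ioi a).Nonempty := ⟨b, hb, ha'.trans_le hab⟩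
  exact ⟨wellFounded_lt.min _ hne, wellFounded_lt.min_mem _ hne,
    fun x hx => not_lt.1 (wellFounded_lt.not_lt_min _ hx)⟩

theorem exists_isCodingTower [WellFoundedLT A] [NoMaxOrder A] (hcof : Order.cof A ≠ ℵ₀)
    (hK : #K < Order.cof A) (c : (A → Bool) → A → Bool)
    (e : A → (K → A → Bool) → K → Bool)
    (hguess : ∀ g : A → Bool, ∃ f : A → Bool, ∃ D, IsClub D ∧ ∀ a ∈ D, c f a = g a)
    (F : K → A → Bool) :
    ∃ H C, H 0 = F ∧ IsCodingTower c e H C := by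
  have step : ∀ p : {p : (K → A → Bool) × Set A // IsClub p.2},
      ∃ q : {p : (K → A → Bool) × Set A // IsClub p.2}, q.1.2 ⊆ p.1.2 ∧
        ∀ a ∈ q.1.2, ∀ b, IsLeast (p.1.2 ∩ Ioi a) b → ∀ k, c (q.1.1 k) a = e b p.1.1 k := by
    rintro ⟨⟨G, D⟩, hD⟩
    choose next hnext using exists_isLeast_inter_Ioi hD.isCofinal
    choose f E hE hf using fun k => hguess fun a => e (next a) G k
    refine ⟨⟨⟨f, D ∩ ⋂ k, E k⟩, hD.inter hcof (.iInter hcof (Cardinal.lift_lt.2 hK) hE)⟩,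
      inter_subset_left, ?_⟩
    intro a ha b hb k
    rw [hb.unique (hnext a)]
    exact hf k a (mem_iInter.1 ha.2 k)
  choose next hsub hcode using step
  let T : ℕ → {p : (K → A → Bool) × Set A // IsClub p.2} :=
    Nat.rec ⟨⟨F, univ⟩, .univ⟩ fun _ p => next p
  exact ⟨fun n => (T n).1.1, fun n => (T n).1.2, rfl, fun n => (T n).2, fun n => hsub (T n),
    fun n => hcode (T n)⟩

theorem IsCodingTower.antitone (h : IsCodingTower c e H C) : Antitone C :=
  antitone_nat_of_succ_le h.succ_subset

theorem IsCodingTower.eqOn_next (h : IsCodingTower c e H C) (h' : IsCodingTower c e H' C')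
    (hc : ∀ f f' a, EqOn f f' (Iio a) → c f a = c f' a)
    (he : ∀ a a' F F', e a F = e a' F' → a = a' ∧ ∀ k, EqOn (F k) (F' k) (Iio a))
    {n : ℕ} {a b b' : A} (ha : a ∈ C (n + 1)) (ha' : a ∈ C' (n + 1))
    (hb : IsLeast (C n ∩ Ioi a) b) (hb' : IsLeast (C' n ∩ Ioi a) b')
    (heq : ∀ k, EqOn (H (n + 1) k) (H' (n + 1) k) (Iio a)) :
    b = b' ∧ ∀ k, EqOn (H n k) (H' n k) (Iio b) := by
  refine he _ _ _ _ (funext fun k => ?_)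
  rw [← h.code n a ha b hb k, ← h'.code n a ha' b' hb' k]
  exact hc _ _ _ (heq k)

theorem IsCodingTower.eqOn_of_le [WellFoundedLT A] [NoMaxOrder A]
    (h : IsCodingTower c e H C) (h' : IsCodingTower c e H' C')
    (hc : ∀ f f' a, EqOn f f' (Iio a) → c f a = c f' a)
    (he : ∀ a a' F F', e a F = e a' F' → a = a' ∧ ∀ k, EqOn (F k) (F' k) (Iio a))
    {m : ℕ} {a : A} (ha : a ∈ C m) (ha' : a ∈ C' m)
    (heq : ∀ k, EqOn (H m k) (H' m k) (Iio a)) {n : ℕ} (hn : n ≤ m) :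
    ∀ k, EqOn (H n k) (H' n k) (Iio a) := by
  induction m with
  | zero => obtain rfl := Nat.le_zero.1 hn; exact heq
  | succ m ih =>
    obtain rfl | hn := hn.eq_or_lt
    · exact heq
    obtain ⟨b, hb⟩ := exists_isLeast_inter_Ioi (h.isClub m).isCofinal a
    obtain ⟨b', hb'⟩ := exists_isLeast_inter_Ioi (h'.isClub m).isCofinal a
    exact ih (h.succ_subset m ha) (h'.succ_subset m ha')
      (fun k => ((h.eqOn_next h' hc he ha ha' hb hb' heq).2 k).mono
        (Iio_subset_Iio hb.1.2.le)) (Nat.lt_succ_iff.1 hn)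

theorem exists_isGreatest_inter_Iic [WellFoundedLT A] {s : Set A} (hs : IsClub s)
    {a b : A} (ha : a ∈ s) (hab : a ≤ b) : ∃ x, IsGreatest (s ∩ Iic b) x := by
  have hne : (upperBounds (s ∩ Iic b)).Nonempty := ⟨b, fun x hx => hx.2⟩
  have hlub : IsLUB (s ∩ Iic b) (wellFounded_lt.min _ hne) :=
    ⟨wellFounded_lt.min_mem _ hne, fun x hx => not_lt.1 (wellFounded_lt.not_lt_min _ hx)⟩
  exact ⟨_, ⟨hs.isLUB_mem inter_subset_left ⟨a, ha, hab⟩ hlub, hlub.2 fun x hx => hx.2⟩, hlub.1⟩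

theorem bddAbove_range_nat [NoMaxOrder A] (hcof : ℵ₀ < Order.cof A) (f : ℕ → A) :
    BddAbove (range f) := by
  rw [← not_isCofinal_iff_bddAbove]
  exact fun hf => (Order.cof_le hf).not_gt (hcof.trans_le' (countable_range f).le_aleph0)

/-- A coding tower is determined by the restrictions of its branches to any common point of its
clubs. -/
theorem IsCodingTower.eq_of_eqOn [WellFoundedLT A] [NoMaxOrder A] (hcof : ℵ₀ < Order.cof A)
    (h : IsCodingTower c e H C) (h' : IsCodingTower c e H' C')
    (hc : ∀ f f' a, EqOn f f' (Iio a) → c f a = c f' a)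
    (he : ∀ a a' F F', e a F = e a' F' → a = a' ∧ ∀ k, EqOn (F k) (F' k) (Iio a))
    {a : A} (ha : ∀ n, a ∈ C n) (ha' : ∀ n, a ∈ C' n)
    (heq : ∀ n k, EqOn (H n k) (H' n k) (Iio a)) : H = H' := by
  by_contra hne
  have hbad : {b | ∃ n k, H n k b ≠ H' n k b}.Nonempty := by
    by_contra! hempty
    refine hne (funext fun n => funext fun k => funext fun b => ?_)
    by_contra hb
    exact hempty.subset ⟨n, k, hb⟩
  obtain ⟨b, ⟨n₀, k₀, hb⟩, hmin⟩ : ∃ b, (∃ n k, H n k b ≠ H' n k b) ∧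
      ∀ n k, EqOn (H n k) (H' n k) (Iio b) := by
    refine ⟨_, wellFounded_lt.min_mem _ hbad, fun n k x hx => ?_⟩
    by_contra hx'
    exact wellFounded_lt.not_lt_min _ (show x ∈ {b | ∃ n k, H n k b ≠ H' n k b} from
      ⟨n, k, hx'⟩) hx
  have hab : a ≤ b := not_lt.1 fun hba => hb (heq n₀ k₀ hba)
  have hD : IsClub (⋂ n, C n ∩ C' n) :=
    .iInter_of_countable hcof.ne' fun n => (h.isClub n).inter hcof.ne' (h'.isClub n)
  obtain ⟨x, ⟨hxD, hxb⟩, hx⟩ :=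
    exists_isGreatest_inter_Iic hD (mem_iInter.2 fun n => ⟨ha n, ha' n⟩) hab
  have hxC n : x ∈ C n := (mem_iInter.1 hxD n).1
  have hxC' n : x ∈ C' n := (mem_iInter.1 hxD n).2
  choose ν hν using fun n => exists_isLeast_inter_Ioi (h.isClub n).isCofinal x
  choose ν' hν' using fun n => exists_isLeast_inter_Ioi (h'.isClub n).isCofinal x
  have key n := h.eqOn_next h' hc he (hxC (n + 1)) (hxC' (n + 1)) (hν n) (hν' n)
    fun k => (hmin _ k).mono (Iio_subset_Iio hxb)
  have hνC' n : ν n ∈ C' n := (key n).1 ▸ (hν' n).1.1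
  have hmono : Monotone ν :=
    monotone_nat_of_le_succ fun n => (hν n).2 ⟨h.succ_subset n (hν (n + 1)).1.1, (hν (n + 1)).1.2⟩
  have hne : (upperBounds (range ν)).Nonempty := bddAbove_range_nat hcof ν
  have hlub : IsLUB (range ν) (wellFounded_lt.min _ hne) :=
    ⟨wellFounded_lt.min_mem _ hne, fun x hx => not_lt.1 (wellFounded_lt.not_lt_min _ hx)⟩
  set s := wellFounded_lt.min _ hne
  have hlub_tail m : IsLUB (range fun n => ν (n + m)) s := by
    refine ⟨?_, fun y hy => hlub.2 ?_⟩
    · rintro _ ⟨n, rfl⟩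
      exact hlub.1 ⟨_, rfl⟩
    · rintro _ ⟨n, rfl⟩
      exact (hmono (Nat.le_add_right n m)).trans (hy ⟨n, rfl⟩)
  have hsD : s ∈ ⋂ n, C n ∩ C' n := by
    refine mem_iInter.2 fun m => ⟨(h.isClub m).isLUB_mem ?_ (range_nonempty _) (hlub_tail m),
      (h'.isClub m).isLUB_mem ?_ (range_nonempty _) (hlub_tail m)⟩
    · rintro _ ⟨n, rfl⟩
      exact h.antitone (Nat.le_add_left m n) (hν _).1.1
    · rintro _ ⟨n, rfl⟩
      exact h'.antitone (Nat.le_add_left m n) (hνC' _)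
  have hbs : b < s := by
    by_contra! hsb
    exact ((hν 0).1.2.trans_le (hlub.1 ⟨0, rfl⟩)).not_ge (hx ⟨hsD, hsb⟩)
  obtain ⟨_, ⟨m, rfl⟩, hm⟩ := (lt_isLUB_iff hlub).1 hbs
  obtain hn | hn := le_total n₀ m
  · exact hb (h.eqOn_of_le h' hc he (hν m).1.1 (hνC' m) (key m).2 hn k₀ hm)
  · exact hb ((key n₀).2 k₀ (hm.trans_le (hmono hn)))

theorem eqOn_of_sigma_eq {I : Type*} {a a' : A} {G G' : I → A → Bool}
    (h : (⟨a, fun p => G p.1 p.2⟩ : Σ a : A, I × Iio a → Bool) = ⟨a', fun p => G' p.1 p.2⟩) :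
    a = a' ∧ ∀ i, EqOn (G i) (G' i) (Iio a) := by
  obtain ⟨rfl, h⟩ := Sigma.mk.inj_iff.1 h
  exact ⟨rfl, fun i b hb => congrFun (eq_of_heq h) (i, ⟨b, hb⟩)⟩

/-- If every `g` is guessed on a club by some branch, then every branch is determined by countably
many families of branches restricted to a bounded initial segment. -/
theorem exists_injective_of_guess [WellFoundedLT A] [NoMaxOrder A]
    [Nonempty A] [Nonempty K] (hcof : ℵ₀ < Order.cof A)
    (hK : #K < Order.cof A) (c : (A → Bool) → A → Bool)
    (e : A → (K → A → Bool) → K → Bool)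
    (hc : ∀ f f' a, EqOn f f' (Iio a) → c f a = c f' a)
    (he : ∀ a a' F F', e a F = e a' F' → a = a' ∧ ∀ k, EqOn (F k) (F' k) (Iio a))
    (hguess : ∀ g : A → Bool, ∃ f : A → Bool, ∃ D, IsClub D ∧ ∀ a ∈ D, c f a = g a) :
    ∃ Φ : (A → Bool) → Σ a : A, (ℕ × K) × Iio a → Bool, Function.Injective Φ := by
  choose H C hH hT using fun h : A → Bool =>
    exists_isCodingTower hcof.ne' hK c e hguess fun _ => h
  choose a ha using fun h : A → Bool =>
    (IsClub.iInter_of_countable hcof.ne' (hT h).isClub).nonempty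
  refine ⟨fun h => ⟨a h, fun p => H h p.1.1 p.1.2 p.2⟩, fun h h' hhh => ?_⟩
  obtain ⟨haa, hHH⟩ := eqOn_of_sigma_eq (G := fun p : ℕ × K => H h p.1 p.2)
    (G' := fun p => H h' p.1 p.2) hhh
  have := (hT h).eq_of_eqOn hcof (hT h') hc he (mem_iInter.1 (ha h))
    (haa ▸ mem_iInter.1 (ha h')) fun n k => hHH (n, k)
  obtain ⟨k⟩ := ‹Nonempty K›
  rw [← congrFun (hH h) k, ← congrFun (hH h') k, this]

end Tower

section Ordinals

universe u

theorem IsClubIn.isClub_preimage {o : Ordinal} {C : Set Ordinal} (hC : IsClubIn o C) :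
    IsClub (Subtype.val ⁻¹' C : Set (Iio o)) := by
  refine ⟨fun d hd hne _ x hx => ?_, fun a => ?_⟩
  · have hlub : IsLUB (Subtype.val '' d) x.1 := by
      refine ⟨?_, fun y hy => ?_⟩
      · rintro _ ⟨z, hz, rfl⟩
        exact hx.1 hz
      · by_contra! hyx
        exact hyx.not_ge (hx.2 (show ⟨y, hyx.trans x.2⟩ ∈ upperBounds d from
          fun z hz => hy ⟨z, hz, rfl⟩))
    have hsup := hlub.csSup_eq (hne.image _)
    have := hC.2 (Subtype.val '' d) (image_subset_iff.2 hd) (hne.image _) (hsup ▸ x.2)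
    rwa [hsup] at this
  · obtain ⟨b, hb, hab⟩ := exists_lt_of_lt_csSup' (hC.1.2.symm ▸ a.2 : a.1 < sSup C)
    exact ⟨⟨b, hC.1.1 hb⟩, hb, hab.le⟩

theorem le_two_power_of_powerlt_eq {lam κ : Cardinal} (h : (2 : Cardinal) ^< lam = 2 ^ κ) :
    lam ≤ 2 ^ κ := by
  by_contra! hlt
  exact (Cardinal.cantor _).not_ge ((le_powerlt 2 hlt).trans h.le)

theorem mk_sigma_prod_Iio_le {lam κ : Cardinal.{u}} (hinf : ℵ₀ ≤ lam)
    (h : (2 : Cardinal) ^< lam = 2 ^ κ) {ι : Type (u + 1)}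
    (hι : #ι < Cardinal.lift.{u + 1} lam) :
    #(Σ a : Iio lam.ord, ι × Iio a → Bool) ≤ Cardinal.lift.{u + 1} (2 ^ κ) := by
  have hinf' : ℵ₀ ≤ Cardinal.lift.{u + 1} lam := aleph0_le_lift.2 hinf
  have hle : Cardinal.lift.{u + 1} lam ≤ Cardinal.lift.{u + 1} (2 ^ κ) :=
    Cardinal.lift_le.2 (le_two_power_of_powerlt_eq h)
  have hfiber (a : Iio lam.ord) : #(ι × Iio a → Bool) ≤ Cardinal.lift.{u + 1} (2 ^ κ) := by
    have hIio : #(Iio a) < Cardinal.lift.{u + 1} lam := by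
      have hinj : #(Iio a) ≤ #(Iio a.1) :=
        Cardinal.mk_le_of_injective (f := fun x => (⟨x.1.1, x.2⟩ : Iio a.1))
          fun x y hxy => Subtype.ext (Subtype.ext (Subtype.mk.inj hxy))
      refine hinj.trans_lt ?_
      rw [Cardinal.mk_Iio_ordinal]
      exact Cardinal.lift_lt.2 (Cardinal.lt_ord.1 a.2)
    have hprod : #(ι × Iio a) < Cardinal.lift.{u + 1} lam := by
      rw [Cardinal.mk_prod, Cardinal.lift_id, Cardinal.lift_id]
      exact Cardinal.mul_lt_of_lt hinf' hι hIio
    obtain ⟨θ, hθ, hθeq⟩ := Cardinal.lt_lift_iff.1 hprod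
    have hpow : #(ι × Iio a → Bool) = 2 ^ #(ι × Iio a) := by simp
    rw [hpow, ← hθeq, ← Cardinal.lift_two_power]
    exact Cardinal.lift_le.2 ((le_powerlt 2 hθ).trans h.le)
  calc #(Σ a : Iio lam.ord, ι × Iio a → Bool)
      ≤ Cardinal.sum fun _ : Iio lam.ord => Cardinal.lift.{u + 1} (2 ^ κ) := by
        rw [Cardinal.mk_sigma]
        exact Cardinal.sum_le_sum _ _ hfiber
    _ = Cardinal.lift.{u + 1} lam * Cardinal.lift.{u + 1} (2 ^ κ) := by
        rw [Cardinal.sum_const', Cardinal.mk_Iio_ordinal, Cardinal.card_ord]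
    _ ≤ Cardinal.lift.{u + 1} (2 ^ κ) :=
        Cardinal.mul_le_of_le (hinf'.trans hle) hle le_rfl

theorem exists_guess_of_not_weakDiamond {o : Ordinal} (h : ¬ WeakDiamond o) :
    ∃ c : Coloring o, ∀ g : Iio o → Bool, ∃ f : Iio o → Bool, ∃ D, IsClub D ∧
      ∀ a ∈ D, c a (restr f a) = g a := by
  simp only [WeakDiamond, not_forall, not_exists] at h
  obtain ⟨c, hc⟩ := h
  refine ⟨c, fun g => ?_⟩
  obtain ⟨f, hf⟩ := hc fun a => !g a
  have hsub : guessSet o c f (fun a => !g a) ⊆ Iio o := fun b hb => hb.1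
  simp only [IsStationaryIn, not_and, not_forall] at hf
  obtain ⟨C, hC, hdisj⟩ := hf hsub
  refine ⟨f, _, hC.isClub_preimage, fun a ha => ?_⟩
  by_contra hne
  exact hdisj ⟨a.1, ⟨a.2, Bool.eq_not_of_ne hne⟩, ha⟩

/-- The weak diamond holds at every uncountable regular `lam` with `2 ^< lam = 2 ^ κ < 2 ^ lam` for
some `κ < lam`. -/
theorem weakDiamond_of_powerlt_eq {lam κ : Cardinal.{u}} (hreg : lam.IsRegular) (hunc : ℵ₀ < lam)
    (hκ : κ < lam) (h1 : (2 : Cardinal) ^< lam = 2 ^ κ) (h2 : (2 : Cardinal) ^ κ < 2 ^ lam) :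
    WeakDiamond lam.ord := by
  by_contra hnot
  obtain ⟨c, hc⟩ := exists_guess_of_not_weakDiamond hnot
  have hlim' := Cardinal.isSuccLimit_ord hreg.aleph0_le
  have : NoMaxOrder (Iio lam.ord) :=
    ⟨fun a => ⟨⟨Order.succ a.1, hlim'.succ_lt a.2⟩, Order.lt_succ a.1⟩⟩
  have : Nonempty (Iio lam.ord) := ⟨⟨0, hreg.ord_pos⟩⟩
  have hcof : Order.cof (Iio lam.ord) = Cardinal.lift.{u + 1} lam := by
    rw [Ordinal.cof_Iio, ← Ordinal.lift_cof, hreg.cof_ord]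
  have hκ0 : κ ≠ 0 := by
    rintro rfl
    have := hunc.trans_le (le_two_power_of_powerlt_eq h1)
    rw [power_zero] at this
    exact this.not_ge Cardinal.one_le_aleph0
  let K := ULift.{u + 1} κ.out
  have hK : #K = Cardinal.lift.{u + 1} κ := by simp [K]
  have : Nonempty K := by
    rw [← Cardinal.mk_ne_zero_iff, hK]
    simpa using hκ0
  have hKlt : #K < Cardinal.lift.{u + 1} lam := hK ▸ Cardinal.lift_lt.2 hκ
  have hKpow : #(K → Bool) = Cardinal.lift.{u + 1} (2 ^ κ) := by simp [hK]
  obtain ⟨E⟩ : Nonempty ((Σ a : Iio lam.ord, K × Iio a → Bool) ↪ (K → Bool)) :=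
    (mk_sigma_prod_Iio_le hreg.aleph0_le h1 hKlt).trans hKpow.ge
  obtain ⟨Φ, hΦ⟩ := exists_injective_of_guess (hcof ▸ Cardinal.aleph0_lt_lift.2 hunc)
    (hcof ▸ hKlt) (fun f a => c a (restr f a)) (fun a F => E ⟨a, fun p => F p.1 p.2⟩)
    (fun f f' a hff => congrArg (c a) (funext fun b => hff b.2))
    (fun a a' F F' hFF => eqOn_of_sigma_eq (E.injective hFF)) hc
  have hNK : #(ℕ × K) < Cardinal.lift.{u + 1} lam := by
    rw [Cardinal.mk_prod]
    exact Cardinal.mul_lt_of_lt (Cardinal.aleph0_le_lift.2 hreg.aleph0_le)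
      (by simpa using hunc) (by simpa using hKlt)
  have hle := (Cardinal.mk_le_of_injective hΦ).trans (mk_sigma_prod_Iio_le hreg.aleph0_le h1 hNK)
  have hA : #(Iio lam.ord → Bool) = Cardinal.lift.{u + 1} (2 ^ lam) := by simp
  rw [hA, Cardinal.lift_le] at hle
  exact hle.not_gt h2

end Ordinals

theorem weakDiamond_of_eventually_constant (lam : Cardinal)
    (hreg : lam.IsRegular) (hunc : Cardinal.aleph0 < lam)
    (hlim : ∀ θ : Cardinal, θ < lam → Order.succ θ < lam)
    (κ : Cardinal) (hκ : κ < lam)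
    (h1 : Cardinal.powerlt 2 lam = (2 : Cardinal) ^ κ)
    (h2 : (2 : Cardinal) ^ κ < (2 : Cardinal) ^ lam) :
    WeakDiamond lam.ord := by
  exact weakDiamond_of_powerlt_eq hreg hunc hκ h1 h2

end WDP
end
end

section
/- Let κ be an infinite cardinal. Then the weak diamond Φ_{κ⁺} holds if and only if 2^κ < 2^{κ⁺}. -/
noncomputable section

open Cardinal Set

namespace WDP

universe u v

/-- The pairs of an `α < o` and an `α`-sequence of elements of `X`. -/
abbrev BoundedSeq (o : Ordinal.{u}) (X : Type v) := Σ α : Set.Iio o, (Set.Iio α.1 → X)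

/-- The initial segment of length `α` of `H : o → X`. -/
def initSeg {o : Ordinal.{u}} {X : Type v} (H : Set.Iio o → X) (α : Set.Iio o) : BoundedSeq o X :=
  ⟨α, fun β => H ⟨β.1, lt_trans (Set.mem_Iio.1 β.2) (Set.mem_Iio.1 α.2)⟩⟩

/-- `d` predicts each `G : o → X` on a club along the initial segments of some `K : o → X`. -/
def Predicts {o : Ordinal.{u}} {X : Type v} (d : BoundedSeq o X → X) : Prop :=
  ∀ G : Set.Iio o → X, ∃ (K : Set.Iio o → X) (C : Set (Set.Iio o)),
    IsClub C ∧ ∀ α ∈ C, d (initSeg K α) = G α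

theorem initSeg_eq_iff {o : Ordinal.{u}} {X : Type v} {H H' : Set.Iio o → X} {α α' : Set.Iio o} :
    initSeg H α = initSeg H' α' ↔ α = α' ∧ ∀ β < α, H β = H' β := by
  constructor
  · intro h
    obtain ⟨h₁, h₂⟩ := Sigma.mk.inj h
    subst h₁
    exact ⟨rfl, fun β hβ => congrFun (eq_of_heq h₂) ⟨β.1, hβ⟩⟩
  · rintro ⟨rfl, h⟩
    unfold initSeg
    congr 1
    funext β
    exact h _ β.2

theorem IsClubIn.isClub_preimage_s11 {o : Ordinal.{u}} {C : Set Ordinal.{u}} (hC : IsClubIn o C) :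
    IsClub {x : Set.Iio o | x.1 ∈ C} := by
  obtain ⟨⟨hsub, hsup⟩, hcl⟩ := hC
  refine ⟨fun d hd hne _ a ha => ?_, fun a => ?_⟩
  · have key : IsLUB (Subtype.val '' d) a.1 := by
      refine ⟨?_, fun b hb => ?_⟩
      · rintro _ ⟨x, hx, rfl⟩
        exact ha.1 hx
      · by_contra! hlt
        have : a ≤ ⟨b, hlt.trans a.2⟩ := ha.2 fun x hx => hb ⟨x, hx, rfl⟩
        exact absurd hlt (not_lt.2 this)
    have hs : sSup (Subtype.val '' d) = a.1 := key.csSup_eq (hne.image _)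
    have := hcl (Subtype.val '' d) (by rintro _ ⟨x, hx, rfl⟩; exact hd hx) (hne.image _)
      (hs ▸ a.2)
    rwa [hs] at this
  · have hlt : a.1 < sSup C := hsup.symm ▸ a.2
    obtain ⟨b, hb, hab⟩ := exists_lt_of_lt_csSup' hlt
    exact ⟨⟨b, hsub hb⟩, hb, hab.le⟩

theorem exists_predicts_bool {o : Ordinal.{u}} (h : ¬ WeakDiamond o) :
    ∃ d : BoundedSeq o Bool → Bool, Predicts d := by
  simp only [WeakDiamond, not_forall, not_exists] at h
  obtain ⟨c, hc⟩ := h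
  refine ⟨fun p => c p.1 p.2, fun g => ?_⟩
  obtain ⟨f, hf⟩ := hc fun α => !(g α)
  have : ∃ C, IsClubIn o C ∧ ¬ (guessSet o c f (fun α => !(g α)) ∩ C).Nonempty := by
    by_contra! H
    exact hf ⟨fun _ hx => hx.1, H⟩
  obtain ⟨C, hC, hdisj⟩ := this
  refine ⟨f, _, hC.isClub_preimage_s11, fun α hα => ?_⟩
  by_contra hne
  exact hdisj ⟨α.1, ⟨α.2, Bool.eq_not_iff.2 hne⟩, hα⟩

theorem Predicts.exists_pi {o : Ordinal.{u}} {d : BoundedSeq o Bool → Bool} (hd : Predicts d)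
    {I : Type (u + 1)} (ho : Order.cof (Set.Iio o) ≠ ℵ₀) (hI : #I < Order.cof (Set.Iio o)) :
    ∃ e : BoundedSeq o (I → Bool) → (I → Bool), Predicts e := by
  refine ⟨fun p i => d ⟨p.1, fun β => p.2 β i⟩, fun G => ?_⟩
  choose K C hC hK using fun i => hd fun α => G α i
  refine ⟨fun α i => K i α, ⋂ i, C i, IsClub.iInter ho (by simpa using hI) hC, fun α hα => ?_⟩
  funext i
  exact hK i α (Set.mem_iInter.1 hα i)

theorem Predicts.exists_decoding {o : Ordinal.{u}} (ho : Order.cof (Set.Iio o) ≠ ℵ₀)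
    [NoMaxOrder (Set.Iio o)] {X : Type v} [Nonempty X] {d : BoundedSeq o X → X} (hd : Predicts d)
    (code : BoundedSeq o X ↪ X) (pair : X × X ↪ X) :
    ∃ (D : BoundedSeq o X → BoundedSeq o X) (pr : X → X), ∀ (H : Set.Iio o → X)
      (C : Set (Set.Iio o)), IsClub C → ∃ (H' : Set.Iio o → X) (C' : Set (Set.Iio o)),
        IsClub C' ∧ C' ⊆ C ∧ (∀ β, H β = pr (H' β)) ∧
        ∀ α ∈ C', ∃ δ, IsLeast (C ∩ Set.Ioi α) δ ∧ D (initSeg H' α) = initSeg H δ := by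
  rcases isEmpty_or_nonempty (Set.Iio o) with hE | ⟨⟨a₀⟩⟩
  · exact ⟨id, id, fun H C hC => ⟨H, C, hC, subset_rfl, fun β => hE.elim β, fun α => hE.elim α⟩⟩
  obtain ⟨x₀⟩ := ‹Nonempty X›
  have : Nonempty (BoundedSeq o X) := ⟨⟨a₀, fun _ => x₀⟩⟩
  have : Nonempty (X × X) := ⟨(x₀, x₀)⟩
  refine ⟨fun p => Function.invFun code (d ⟨p.1, fun β => (Function.invFun pair (p.2 β)).2⟩),
    fun x => (Function.invFun pair x).1, fun H C hC => ?_⟩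
  have hnext : ∀ α, ∃ δ, IsLeast (C ∩ Set.Ioi α) δ := fun α => by
    obtain ⟨b, hb⟩ := exists_gt α
    obtain ⟨c, hc, hbc⟩ := hC.isCofinal b
    have hne : (C ∩ Set.Ioi α).Nonempty := ⟨c, hc, hb.trans_le hbc⟩
    exact ⟨_, wellFounded_lt.min_mem _ hne, fun x hx => not_lt.1 (wellFounded_lt.not_lt_min _ hx)⟩
  choose nx hnx using hnext
  obtain ⟨K, C₁, hC₁, hK⟩ := hd fun α => code (initSeg H (nx α))
  refine ⟨fun β => pair (H β, K β), C ∩ C₁, hC.inter ho hC₁, Set.inter_subset_left,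
    fun β => by simp [Function.leftInverse_invFun pair.injective _], fun α hα => ?_⟩
  refine ⟨nx α, hnx α, ?_⟩
  have := hK α hα.2
  simp only [initSeg] at this
  simp [initSeg, Function.leftInverse_invFun pair.injective _, this,
    Function.leftInverse_invFun code.injective _]

theorem Predicts.nonempty_embedding {o : Ordinal.{u}} (ho : ℵ₀ < Order.cof (Set.Iio o))
    [NoMaxOrder (Set.Iio o)] [Nonempty (Set.Iio o)] {X : Type v} [Nonempty X]
    {d : BoundedSeq o X → X} (hd : Predicts d)
    (code : BoundedSeq o X ↪ X) (pair : X × X ↪ X) (b : Bool ↪ X) :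
    Nonempty ((Set.Iio o → Bool) ↪ (ℕ → BoundedSeq o X)) := by
  obtain ⟨D, pr, hstep⟩ := hd.exists_decoding ho.ne' code pair
  choose! nH nC hclub hsub hpr hD using hstep
  let S (g : Set.Iio o → Bool) (n : ℕ) : (Set.Iio o → X) × Set (Set.Iio o) :=
    Nat.rec (fun β => b (g β), Set.univ) (fun _ p => (nH p.1 p.2, nC p.1 p.2)) n
  have hS0 : ∀ g, S g 0 = (fun β => b (g β), Set.univ) := fun g => rfl
  have hSs : ∀ g n, S g (n + 1) = (nH (S g n).1 (S g n).2, nC (S g n).1 (S g n).2) :=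
    fun g n => rfl
  have hSc : ∀ g n, IsClub (S g n).2 := fun g n => by
    induction n with
    | zero => exact IsClub.univ
    | succ n ih => rw [hSs]; exact hclub _ _ ih
  have hanti : ∀ g, Antitone fun n => (S g n).2 := fun g =>
    antitone_nat_of_succ_le fun n => by rw [hSs]; exact hsub _ _ (hSc g n)
  have hproj : ∀ g n β, (S g n).1 β = pr ((S g (n + 1)).1 β) := fun g n β => by
    rw [hSs]; exact hpr _ _ (hSc g n) β
  have hdec : ∀ g n, ∀ α ∈ (S g (n + 1)).2, ∃ δ, IsLeast ((S g n).2 ∩ Set.Ioi α) δ ∧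
      D (initSeg (S g (n + 1)).1 α) = initSeg (S g n).1 δ := fun g n => by
    rw [hSs]; exact hD _ _ (hSc g n)
  clear_value S
  have hInt : ∀ g, IsClub (⋂ n, (S g n).2) := fun g =>
    IsClub.iInter_of_countable ho.ne' (hSc g)
  choose δ₀ hδ₀ using fun g => (hInt g).nonempty
  refine ⟨⟨fun g n => initSeg (S g n).1 (δ₀ g), fun g g' hgg => ?_⟩⟩
  have hinit := fun n => initSeg_eq_iff.1 (congrFun hgg n)
  have hdown : ∀ m n, n ≤ m → ∀ β, (S g m).1 β = (S g' m).1 β → (S g n).1 β = (S g' n).1 β := by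
    intro m n hnm β
    induction m, hnm using Nat.le_induction with
    | base => exact id
    | succ m _ ih => intro h; exact ih (by rw [hproj g, hproj g', h])
  let A : Set (Set.Iio o) :=
    {δ | (∀ n, δ ∈ (S g n).2 ∧ δ ∈ (S g' n).2) ∧ ∀ n, ∀ β < δ, (S g n).1 β = (S g' n).1 β}
  have hA0 : δ₀ g ∈ A := by
    refine ⟨fun n => ⟨Set.mem_iInter.1 (hδ₀ g) n, ?_⟩, fun n => (hinit n).2⟩
    rw [(hinit 0).1]
    exact Set.mem_iInter.1 (hδ₀ g') n
  let := WellFoundedLT.toOrderBot (α := Set.Iio o)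
  let := WellFoundedLT.conditionallyCompleteLinearOrderBot (Set.Iio o)
  have hAsup : ∀ B ⊆ A, B.Nonempty → BddAbove B → sSup B ∈ A := by
    intro B hB hne hb
    refine ⟨fun n => ⟨(hSc g n).csSup_mem (fun x hx => ((hB hx).1 n).1) hne hb,
      (hSc g' n).csSup_mem (fun x hx => ((hB hx).1 n).2) hne hb⟩, fun n β hβ => ?_⟩
    obtain ⟨x, hx, hβx⟩ := exists_lt_of_lt_csSup hne hβ
    exact (hB hx).2 n β hβx
  have hAsucc : ∀ δ ∈ A, ∃ ε ∈ A, δ < ε := by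
    intro δ hδ
    choose ε hε hεD using fun n => hdec g n δ (hδ.1 (n + 1)).1
    choose ε' hε' hεD' using fun n => hdec g' n δ (hδ.1 (n + 1)).2
    have hag : ∀ n, ε n = ε' n ∧ ∀ β < ε n, (S g n).1 β = (S g' n).1 β := fun n => by
      rw [← initSeg_eq_iff, ← hεD, ← hεD',
        initSeg_eq_iff.2 ⟨rfl, hδ.2 (n + 1)⟩]
    have hmono : Monotone ε := monotone_nat_of_le_succ fun n =>
      (hε n).2 ⟨hanti g n.le_succ (hε (n + 1)).1.1, (hε (n + 1)).1.2⟩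
    have hbdd : BddAbove (Set.range ε) := by
      refine .of_not_isCofinal fun h => (Order.cof_le h).not_gt (ho.trans_le' ?_)
      simpa using mk_range_le_lift (f := ε)
    have htail : ∀ n, IsLUB (ε '' Set.Ici n) (⨆ m, ε m) := fun n => by
      refine ⟨?_, fun x hx => ciSup_le fun m => ?_⟩
      · rintro _ ⟨m, _, rfl⟩
        exact le_ciSup hbdd m
      · exact (hmono (le_max_left m n)).trans (hx ⟨_, le_max_right m n, rfl⟩)
    refine ⟨⨆ m, ε m, ⟨fun n => ⟨?_, ?_⟩, fun n β hβ => ?_⟩, (hε 0).1.2.trans_le (le_ciSup hbdd 0)⟩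
    · refine (hSc g n).isLUB_mem ?_ (Set.nonempty_Ici.image _) (htail n)
      rintro _ ⟨m, hm, rfl⟩
      exact hanti g hm (hε m).1.1
    · refine (hSc g' n).isLUB_mem ?_ (Set.nonempty_Ici.image _) (htail n)
      rintro _ ⟨m, hm, rfl⟩
      rw [(hag m).1]
      exact hanti g' hm (hε' m).1.1
    · obtain ⟨m, hm⟩ := exists_lt_of_lt_ciSup hβ
      exact hdown (max m n) n (le_max_right _ _) β
        ((hag _).2 β (hm.trans_le (hmono (le_max_left _ _))))
  have hunb : ¬ BddAbove A := fun hb => by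
    obtain ⟨ε, hε, hlt⟩ := hAsucc _ (hAsup A subset_rfl ⟨_, hA0⟩ hb)
    exact (le_csSup hb hε).not_gt hlt
  funext β
  obtain ⟨δ, hδ, hβ⟩ := not_bddAbove_iff.1 hunb β
  have := hδ.2 0 β hβ
  rw [hS0, hS0] at this
  exact b.injective this

theorem mk_boundedSeq_le {κ : Cardinal.{u}} (hκ : ℵ₀ ≤ κ) {X : Type (u + 1)}
    (hX : #X = 2 ^ Cardinal.lift.{u + 1} κ) :
    #(BoundedSeq (Order.succ κ).ord X) ≤ #X := by
  have hK : ℵ₀ ≤ Cardinal.lift.{u + 1} κ := by simpa using hκ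
  rw [mk_sigma]
  refine (Cardinal.sum_le_sum _ (fun _ => #X) fun α => ?_).trans ?_
  · have hα : #(Set.Iio α.1) ≤ Cardinal.lift.{u + 1} κ := by
      rw [mk_Iio_ordinal, Cardinal.lift_le]
      exact Order.lt_succ_iff.1 (lt_ord.1 α.2)
    rw [← power_def, hX, ← power_mul]
    exact power_le_power_left two_ne_zero ((mul_le_mul_right hα _).trans_eq (mul_eq_self hK))
  · rw [sum_const', mk_Iio_ordinal, card_ord, lift_succ, hX]
    have h2 : ℵ₀ ≤ (2 : Cardinal) ^ Cardinal.lift.{u + 1} κ := hK.trans (cantor _).le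
    exact (mul_le_mul_left (Order.succ_le_of_lt (cantor _)) _).trans_eq (mul_eq_self h2)

theorem weakDiamond_of_two_power_lt {κ : Cardinal.{u}} (hκ : ℵ₀ ≤ κ)
    (h : (2 : Cardinal) ^ κ < 2 ^ Order.succ κ) : WeakDiamond (Order.succ κ).ord := by
  by_contra hW
  have hreg := isRegular_succ hκ
  have hK : ℵ₀ ≤ Cardinal.lift.{u + 1} κ := by simpa using hκ
  have hlim : Order.IsSuccLimit (Order.succ κ).ord := isSuccLimit_ord hreg.1
  have hcof : Order.cof (Set.Iio (Order.succ κ).ord) = Order.succ (Cardinal.lift.{u + 1} κ) := by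
    rw [Ordinal.cof_Iio, ← Ordinal.lift_cof, hreg.cof_ord, lift_succ]
  have hcof_gt : ℵ₀ < Order.cof (Set.Iio (Order.succ κ).ord) := by
    rw [hcof]; exact Order.lt_succ_of_le hK
  have : NoMaxOrder (Set.Iio (Order.succ κ).ord) :=
    ⟨fun a => ⟨⟨_, hlim.succ_lt a.2⟩, Order.lt_succ a.1⟩⟩
  have : Nonempty (Set.Iio (Order.succ κ).ord) := ⟨⟨0, hlim.bot_lt⟩⟩
  have hI : #(Set.Iio κ.ord) = Cardinal.lift.{u + 1} κ := by rw [mk_Iio_ordinal, card_ord]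
  have hX : #(Set.Iio κ.ord → Bool) = 2 ^ Cardinal.lift.{u + 1} κ := by
    simp [hI]
  have hXinf : ℵ₀ ≤ #(Set.Iio κ.ord → Bool) := by rw [hX]; exact hK.trans (cantor _).le
  obtain ⟨d, hd⟩ := exists_predicts_bool hW
  obtain ⟨e, he⟩ := hd.exists_pi (I := Set.Iio κ.ord) hcof_gt.ne'
    (by rw [hI, hcof]; exact Order.lt_succ _)
  obtain ⟨code⟩ := mk_boundedSeq_le hκ hX
  obtain ⟨pair⟩ : #((Set.Iio κ.ord → Bool) × (Set.Iio κ.ord → Bool)) ≤ #(Set.Iio κ.ord → Bool) := by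
    rw [mk_prod, Cardinal.lift_id, mul_eq_self hXinf]
  have : Nonempty (Set.Iio κ.ord) :=
    mk_ne_zero_iff.1 (by rw [hI]; exact (aleph0_pos.trans_le hK).ne')
  obtain ⟨emb⟩ := he.nonempty_embedding hcof_gt code pair
    ⟨fun x _ => x, fun x y hxy => congrFun hxy (Classical.arbitrary _)⟩
  have hle := mk_le_of_injective emb.injective
  simp only [mk_arrow, mk_Iio_ordinal, card_ord, mk_bool, mk_nat, lift_succ, lift_two,
    lift_aleph0, lift_uzero] at hle
  have hle' := hle.trans (power_le_power_right (mk_boundedSeq_le hκ hX))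
  rw [hX, ← power_mul, mul_aleph0_eq hK] at hle'
  have h' := Cardinal.lift_lt.{u, u + 1}.2 h
  rw [lift_power, lift_power, lift_succ, lift_two] at h'
  exact hle'.not_gt h'

theorem isClubIn_Ico {o a : Ordinal.{u}} (ho : Order.IsSuccLimit o) (ha : a < o) :
    IsClubIn o (Set.Ico a o) := by
  have hlub : IsLUB (Set.Ico a o) o := by
    refine ⟨fun x hx => hx.2.le, fun b hb => ?_⟩
    by_contra! hbo
    have hmem : Order.succ (max a b) ∈ Set.Ico a o :=
      ⟨(le_max_left a b).trans (Order.le_succ _), ho.succ_lt (max_lt ha hbo)⟩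
    exact ((le_max_right a b).trans_lt (Order.lt_succ _)).not_ge (hb hmem)
  refine ⟨⟨fun x hx => hx.2, hlub.csSup_eq ⟨a, le_rfl, ha⟩⟩, fun s hs ⟨x, hx⟩ hlt => ⟨?_, hlt⟩⟩
  exact (hs hx).1.trans (le_csSup ⟨o, fun y hy => (hs hy).2.le⟩ hx)

theorem WeakDiamond.two_power_lt {κ : Cardinal.{u}} (hκ : ℵ₀ ≤ κ)
    (hW : WeakDiamond (Order.succ κ).ord) : (2 : Cardinal) ^ κ < 2 ^ Order.succ κ := by
  by_contra! hle
  have hlt : κ.ord < (Order.succ κ).ord := ord_lt_ord.2 (Order.lt_succ κ)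
  have hcard : #(Set.Iio (Order.succ κ).ord → Bool) ≤ #(Set.Iio κ.ord → Bool) := by
    have := Cardinal.lift_le.{u + 1}.2 hle
    simpa using this
  obtain ⟨φ⟩ := hcard
  let c : Coloring (Order.succ κ).ord := fun α f =>
    if h : κ.ord ≤ α.1 then
      !(Function.invFun φ (fun β => f ⟨β.1, β.2.trans_le h⟩) α)
    else false
  obtain ⟨g, hg⟩ := hW c
  let f : Set.Iio (Order.succ κ).ord → Bool :=
    fun β => if h : β.1 < κ.ord then φ g ⟨β.1, h⟩ else false
  obtain ⟨α, ⟨hα, hc⟩, hκα, -⟩ := (hg f).2 _ (isClubIn_Ico (isSuccLimit_ord (isRegular_succ hκ).1) hlt)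
  have hf : (fun β : Set.Iio κ.ord =>
      restr f ⟨α, hα⟩ ⟨β.1, β.2.trans_le hκα⟩) = φ g := by
    funext β
    have hβ : β.1 < κ.ord := β.2
    simp [restr, f, hβ]
  simp only [c, dif_pos hκα, hf, Function.leftInverse_invFun φ.injective g] at hc
  simp at hc

theorem weakDiamond_succ_iff (κ : Cardinal) (hκ : Cardinal.aleph0 ≤ κ) :
    WeakDiamond (Order.succ κ).ord ↔ (2 : Cardinal) ^ κ < (2 : Cardinal) ^ (Order.succ κ) := by
  exact ⟨WeakDiamond.two_power_lt hκ, weakDiamond_of_two_power_lt hκ⟩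

end WDP
end
end

section
/- If λ is a subtle cardinal then the diamond principle ◊_λ holds. -/
noncomputable section

open Cardinal Set

namespace WDP

/-- `κ` is a subtle cardinal. -/
def IsSubtleCard (κ : Cardinal) : Prop :=
  κ.IsRegular ∧ Cardinal.aleph0 < κ ∧
  ∀ A : Set.Iio κ.ord → Set Ordinal, (∀ α : Set.Iio κ.ord, A α ⊆ Set.Iio α.1) →
    ∀ C, IsClubIn κ.ord C → ∃ α β : Set.Iio κ.ord,
      α.1 ∈ C ∧ β.1 ∈ C ∧ α.1 < β.1 ∧ A α = A β ∩ Set.Iio α.1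

/-- The accumulation points below `o` of a set of ordinals. -/
def accPts (o : Ordinal) (C : Set Ordinal) : Set Ordinal :=
  {α | α < o ∧ α ≠ 0 ∧ ∀ γ < α, ∃ δ ∈ C, γ < δ ∧ δ < α}

theorem bddAbove_of_subset_Iio {o : Ordinal} {S : Set Ordinal} (h : S ⊆ Set.Iio o) :
    BddAbove S :=
  ⟨o, fun _ hx => (h hx).le⟩

theorem isUnboundedIn_of_forall_lt {o : Ordinal} {S : Set Ordinal} (hS : S ⊆ Set.Iio o)
    (h : ∀ γ < o, ∃ δ ∈ S, γ < δ) : IsUnboundedIn o S := by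
  refine ⟨hS, le_antisymm (csSup_le' fun x hx => (hS hx).le) ?_⟩
  by_contra! hlt
  obtain ⟨δ, hδ, hlt'⟩ := h _ hlt
  exact hlt'.not_ge (le_csSup (bddAbove_of_subset_Iio hS) hδ)

theorem IsUnboundedIn.exists_gt {o : Ordinal} {S : Set Ordinal} (hS : IsUnboundedIn o S)
    {γ : Ordinal} (hγ : γ < o) : ∃ δ ∈ S, γ < δ := by
  by_contra! h
  exact (csSup_le' h).not_gt (hS.2.symm ▸ hγ)

theorem isSuccPrelimit_of_mem_accPts {o : Ordinal} {C : Set Ordinal} {α : Ordinal}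
    (hα : α ∈ accPts o C) : Order.IsSuccPrelimit α :=
  fun γ hγ => by
    obtain ⟨δ, -, h₁, h₂⟩ := hα.2.2 γ hγ.lt
    exact hγ.2 h₁ h₂

theorem isClubIn_inter_Iio {o : Ordinal} {C : Set Ordinal} (hC : IsClubIn o C) {α : Ordinal}
    (hα : α ∈ accPts o C) : IsClubIn α (C ∩ Set.Iio α) := by
  refine ⟨isUnboundedIn_of_forall_lt Set.inter_subset_right fun γ hγ => ?_, fun s hs hne hlt => ?_⟩
  · obtain ⟨δ, hδ, h₁, h₂⟩ := hα.2.2 γ hγ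
    exact ⟨δ, ⟨hδ, h₂⟩, h₁⟩
  · exact ⟨hC.2 s (hs.trans Set.inter_subset_left) hne (hlt.trans hα.1), hlt⟩

theorem IsClubIn.nonempty {o : Ordinal} {C : Set Ordinal} (hC : IsClubIn o C) (ho : o ≠ 0) :
    C.Nonempty := by
  obtain ⟨δ, hδ, -⟩ := hC.1.exists_gt (pos_iff_ne_zero.2 ho)
  exact ⟨δ, hδ⟩

theorem accPts_subset {o : Ordinal} {C : Set Ordinal} (hC : IsClubIn o C) : accPts o C ⊆ C := by
  intro α hα
  have hcl := isClubIn_inter_Iio hC hα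
  rw [← hcl.1.2]
  exact hC.2 _ Set.inter_subset_left (hcl.nonempty hα.2.1) (hcl.1.2.symm ▸ hα.1)

theorem isClubIn_accPts {κ : Cardinal} (hreg : κ.IsRegular) (hunc : ℵ₀ < κ) {C : Set Ordinal}
    (hC : IsClubIn κ.ord C) : IsClubIn κ.ord (accPts κ.ord C) := by
  refine ⟨isUnboundedIn_of_forall_lt (fun _ h => h.1) fun γ hγ => ?_, fun s hs hne hlt => ?_⟩
  · have hex (x : Set.Iio κ.ord) : ∃ y : Set.Iio κ.ord, y.1 ∈ C ∧ x.1 < y.1 := by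
      obtain ⟨δ, hδ, h⟩ := hC.1.exists_gt x.2
      exact ⟨⟨δ, hC.1.1 hδ⟩, hδ, h⟩
    choose f hfC hf using hex
    let g (n : ℕ) : Set.Iio κ.ord := f^[n] ⟨γ, hγ⟩
    have hg (n : ℕ) : g (n + 1) = f (g n) := Function.iterate_succ_apply' f n _
    have hle (n : ℕ) : (g n).1 ≤ ⨆ n, (g n).1 := Ordinal.le_iSup (fun n => (g n).1) n
    have hlt (n : ℕ) : (g n).1 < ⨆ n, (g n).1 :=
      ((hf _).trans_eq (by rw [hg])).trans_le (hle (n + 1))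
    refine ⟨⨆ n, (g n).1, ⟨?_, (bot_le.trans_lt (hlt 0)).ne', fun x hx => ?_⟩, hlt 0⟩
    · refine Ordinal.lift_iSup_lt_of_lt_cof (a := κ.ord) ?_ fun n => Set.mem_Iio.1 (g n).2
      simpa [hreg.cof_ord] using hunc
    · obtain ⟨n, hn⟩ := Ordinal.lt_iSup_iff.1 hx
      exact ⟨(g (n + 1)).1, hg n ▸ hfC _, hn.trans ((hf _).trans_eq (by rw [hg])), hlt _⟩
  · have hbdd := bddAbove_of_subset_Iio fun x hx => (hs hx).1
    refine ⟨hlt, ?_, fun x hx => ?_⟩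
    · obtain ⟨x, hx⟩ := hne
      exact ((pos_iff_ne_zero.2 (hs hx).2.1).trans_le (le_csSup hbdd hx)).ne'
    · obtain ⟨y, hy, hxy⟩ := exists_lt_of_lt_csSup hne hx
      obtain ⟨δ, hδ, h₁, h₂⟩ := (hs hy).2.2 x hxy
      exact ⟨δ, hδ, h₁, h₂.trans_le (le_csSup hbdd hy)⟩

/-- The pair `p` consists of a subset of `α` and a club of limit points of `α` on which the
sequence `A` fails to guess that subset. -/
structure IsUnguessed (α : Ordinal) (A : (β : Ordinal) → β < α → Set Ordinal × Set Ordinal)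
    (p : Set Ordinal × Set Ordinal) : Prop where
  subset : p.1 ⊆ Set.Iio α
  club : IsClubIn α p.2
  prelimit : ∀ β ∈ p.2, Order.IsSuccPrelimit β
  ne : ∀ β (h : β < α), β ∈ p.2 → (A β h).1 ≠ p.1 ∩ Set.Iio β

open Classical in
/-- The sequence choosing at each `α`, if possible, a pair on which its predecessors fail. -/
def unguessedSeq (α : Ordinal) : Set Ordinal × Set Ordinal :=
  if h : ∃ p, IsUnguessed α (fun β _ => unguessedSeq β) p then h.choose else (∅, ∅)
termination_by α

theorem isUnguessed_unguessedSeq {α : Ordinal} {p : Set Ordinal × Set Ordinal}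
    (h : IsUnguessed α (fun β _ => unguessedSeq β) p) :
    IsUnguessed α (fun β _ => unguessedSeq β) (unguessedSeq α) := by
  have hex : ∃ p, IsUnguessed α (fun β _ => unguessedSeq β) p := ⟨p, h⟩
  rw [unguessedSeq.eq_1 α, dif_pos hex]
  exact hex.choose_spec

theorem unguessedSeq_fst_subset (α : Ordinal) : (unguessedSeq α).1 ⊆ Set.Iio α := by
  by_cases h : ∃ p, IsUnguessed α (fun β _ => unguessedSeq β) p
  · exact (isUnguessed_unguessedSeq h.choose_spec).subset
  · rw [unguessedSeq, dif_neg h]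
    exact Set.empty_subset _

/-- A code for a pair of sets of ordinals, faithful if the second consists of limits. -/
def pairCode (p : Set Ordinal × Set Ordinal) : Set Ordinal :=
  Order.succ '' p.1 ∪ p.2

theorem succ_mem_pairCode {p : Set Ordinal × Set Ordinal}
    (hp : ∀ β ∈ p.2, Order.IsSuccPrelimit β) {ξ : Ordinal} :
    Order.succ ξ ∈ pairCode p ↔ ξ ∈ p.1 := by
  constructor
  · rintro (⟨η, hη, h⟩ | h)
    · rwa [← Order.succ_injective h]
    · exact absurd (hp _ h) (Order.not_isSuccPrelimit_succ ξ)
  · exact fun h => Or.inl ⟨ξ, h, rfl⟩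

theorem mem_pairCode_of_isSuccPrelimit {p : Set Ordinal × Set Ordinal} {ξ : Ordinal}
    (hξ : Order.IsSuccPrelimit ξ) : ξ ∈ pairCode p ↔ ξ ∈ p.2 := by
  refine ⟨?_, Or.inr⟩
  rintro (⟨η, -, rfl⟩ | h)
  · exact absurd hξ (Order.not_isSuccPrelimit_succ η)
  · exact h

theorem diamond_of_subtle (lam : Cardinal)
    (hsub : IsSubtleCard lam) : Diamond lam.ord := by
  obtain ⟨hreg, hunc, hsub⟩ := hsub
  refine ⟨fun α => (unguessedSeq α.1).1, fun α => unguessedSeq_fst_subset α.1,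
    fun X hX => ⟨fun β hβ => hβ.1, fun C hC => ?_⟩⟩
  by_contra hne
  have hbad (β : Ordinal) (hβ : β ∈ C) : (unguessedSeq β).1 ≠ X ∩ Set.Iio β :=
    fun h => hne ⟨β, ⟨hC.1.1 hβ, h⟩, hβ⟩
  have hD := isClubIn_accPts hreg hunc hC
  have key (α : Ordinal) (hα : α ∈ accPts lam.ord (accPts lam.ord C)) :
      IsUnguessed α (fun β _ => unguessedSeq β) (unguessedSeq α) := by
    refine isUnguessed_unguessedSeq (p := (X ∩ Set.Iio α, accPts lam.ord C ∩ Set.Iio α))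
      ⟨Set.inter_subset_right, isClubIn_inter_Iio hD hα,
        fun β hβ => isSuccPrelimit_of_mem_accPts hβ.1, fun β hβα hβ => ?_⟩
    have hmin : X ∩ Set.Iio α ∩ Set.Iio β = X ∩ Set.Iio β := by
      rw [Set.inter_assoc, Set.Iio_inter_Iio, min_eq_right hβα.le]
    exact hmin ▸ hbad β (accPts_subset hC hβ.1)
  obtain ⟨⟨α, hαo⟩, ⟨β, hβo⟩, hα, hβ, hαβ, heq⟩ :=
    hsub (fun α => pairCode (unguessedSeq α.1) ∩ Set.Iio α.1) (fun _ => Set.inter_subset_right)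
      _ (isClubIn_accPts hreg hunc hD)
  simp only at hα hβ hαβ heq
  have hiff (ξ : Ordinal) (hξ : ξ < α) :
      ξ ∈ pairCode (unguessedSeq α) ↔ ξ ∈ pairCode (unguessedSeq β) := by
    have := Set.ext_iff.1 heq ξ
    simpa [hξ, hξ.trans hαβ] using this
  have hUα := key α hα
  have hUβ := key β hβ
  have hsubset : (unguessedSeq α).2 ⊆ (unguessedSeq β).2 := fun ξ hξ => by
    have hlim := hUα.prelimit ξ hξ
    rw [← mem_pairCode_of_isSuccPrelimit hlim] at hξ ⊢
    exact (hiff ξ (hUα.club.1.1 (mem_pairCode_of_isSuccPrelimit hlim |>.1 hξ))).1 hξ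
  have hsup := hUα.club.1.2
  have hmem : α ∈ (unguessedSeq β).2 := by
    have := hUβ.club.2 _ hsubset (hUα.club.nonempty hα.2.1) (hsup.symm ▸ hαβ)
    rwa [hsup] at this
  refine hUβ.ne α hαβ hmem (Set.ext fun ξ => ?_)
  have hξ (h : ξ < α) : ξ ∈ (unguessedSeq α).1 ↔ ξ ∈ (unguessedSeq β).1 := by
    rw [← succ_mem_pairCode hUα.prelimit, ← succ_mem_pairCode hUβ.prelimit]
    exact hiff _ ((isSuccPrelimit_of_mem_accPts hα).succ_lt h)
  exact ⟨fun h => ⟨(hξ (hUα.subset h)).1 h, hUα.subset h⟩, fun h => (hξ h.2).2 h.1⟩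

end WDP
end
end
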